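/- The number of reduced words for the long word w0 = [7,6,5,4,3,2,1] in S_7 is exactly 1,100,742,656. -/

import Mathlib

/-- The adjacent transposition `s_a`, swapping `a` and `a+1`, as a permutation of `ℕ`. -/
def adjTransposition (a : ℕ) : Equiv.Perm ℕ := Equiv.swap a (a + 1)

/-- The long word `w₀ = [n, n-1, …, 2, 1]` in `S_n`: the permutation of `ℕ` sending
`i` to `n + 1 - i` for `i ∈ {1, …, n}` and fixing all other natural numbers. -/
def longWord (n : ℕ) : Equiv.Perm ℕ :=
  Function.Involutive.toPerm (fun i => if 1 ≤ i ∧ i ≤ n then n + 1 - i else i)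
    (by intro i; dsimp only; split_ifs <;> omega)

/-- `w` is a reduced word for the long word in `S_n`: a sequence of letters in
`{1, …, n-1}` of length `C(n,2)` whose associated product of adjacent
transpositions `s_{a_1} s_{a_2} ⋯ s_{a_m}` equals `w₀`. -/
def IsReducedWord (n : ℕ) (w : List ℕ) : Prop :=
  w.length = n.choose 2 ∧ (∀ a ∈ w, 1 ≤ a ∧ a ≤ n - 1) ∧
    (w.map adjTransposition).prod = longWord n

/-- Auxiliary recursion computing the induced word on a subset `A` of wires:
`π` is the current permutation `π_{k-1}` (with `π j` the wire in position `j`);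
at a step with letter `a`, the wires `π a` and `π (a+1)` cross, and if both lie
in `A` we record the position of `a` among the positions currently occupied by
the wires of `A`. -/
def inducedAux (A : Finset ℕ) : List ℕ → Equiv.Perm ℕ → List ℕ
  | [], _ => []
  | a :: rest, π =>
      (if π a ∈ A ∧ π (a + 1) ∈ A
        then [((Finset.Icc 1 a).filter (fun p => π p ∈ A)).card]
        else []) ++ inducedAux A rest (π * adjTransposition a)

/-- The induced word of the word `w` on the subset `A` of wires. -/
def inducedWord (w : List ℕ) (A : Finset ℕ) : List ℕ := inducedAux A w 1

/-- The reentrant set `X` of four reduced words for the long word in `S_4`. -/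
def reentrantSet : Finset (List ℕ) :=
  {[1,2,3,2,1,2], [3,2,1,2,3,2], [2,1,2,3,2,1], [2,3,2,1,2,3]}

/-- Swap the entries of a list in positions `i` and `i + 1` (counting from `0`). -/
def swapAt : ℕ → List ℕ → List ℕ
  | 0, x :: y :: t => y :: x :: t
  | i + 1, x :: t => x :: swapAt i t
  | _, l => l

/-- All lists obtained by swapping two adjacent entries. -/
def adjSwaps : List ℕ → List (List ℕ)
  | x :: y :: t => (y :: x :: t) :: (adjSwaps (y :: t)).map (x :: ·)
  | _ => []

/-- All lists obtained by swapping two adjacent entries forming an ascent. -/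
def ascSwaps : List ℕ → List (List ℕ)
  | x :: y :: t =>
      cond (Nat.blt x y) ((y :: x :: t) :: (ascSwaps (y :: t)).map (x :: ·))
        ((ascSwaps (y :: t)).map (x :: ·))
  | _ => []

/-- The number of inversions of a list. -/
def invCount : List ℕ → ℕ
  | [] => 0
  | x :: t => t.countP (· < x) + invCount t

/-- The number of length-`m` sequences of adjacent swaps turning `l` into `target`. -/
def pathCount (target : List ℕ) : ℕ → List ℕ → ℕ
  | 0, l => if l = target then 1 else 0
  | m + 1, l => ((adjSwaps l).map (pathCount target m)).sum

/-- The number of length-`m` sequences of swaps at ascents turning `l` into `target`. -/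
def ascPathCount (target : List ℕ) : ℕ → List ℕ → ℕ
  | 0, l => if l = target then 1 else 0
  | m + 1, l => ((ascSwaps l).map (ascPathCount target m)).sum

theorem perm_of_mem_ascSwaps {l l' : List ℕ} (h : l' ∈ ascSwaps l) :
    l'.Perm l ∧ invCount l' ≤ invCount l + 1 := by
  induction l using adjSwaps.induct generalizing l' with
  | case1 x y t ih =>
    have tail : ∀ l' ∈ (ascSwaps (y :: t)).map (x :: ·),
        l'.Perm (x :: y :: t) ∧ invCount l' ≤ invCount (x :: y :: t) + 1 := by
      intro l' h
      obtain ⟨s, hs, rfl⟩ := List.mem_map.1 h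
      obtain ⟨h1, h2⟩ := ih hs
      refine ⟨h1.cons x, ?_⟩
      rw [invCount, invCount, h1.countP_eq]
      omega
    rw [ascSwaps] at h
    cases hxy : Nat.blt x y
    · rw [hxy] at h
      exact tail l' h
    · rw [hxy] at h
      rcases List.mem_cons.1 h with rfl | h
      · refine ⟨List.Perm.swap x y t, ?_⟩
        simp only [invCount, List.countP_cons]
        split_ifs <;> omega
      · exact tail l' h
  | case2 l hl =>
    rw [ascSwaps] at h
    · simp at h
    · exact hl

theorem sum_adjSwaps_eq_sum_ascSwaps (l : List ℕ) (f : List ℕ → ℕ)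
    (hf : ∀ l', l'.Perm l → invCount l' ≤ invCount l → f l' = 0) :
    ((adjSwaps l).map f).sum = ((ascSwaps l).map f).sum := by
  induction l using adjSwaps.induct generalizing f with
  | case1 x y t ih =>
    have tail := ih (fun s => f (x :: s)) (by
      intro l' h1 h2
      refine hf _ (h1.cons x) ?_
      rw [invCount, invCount, h1.countP_eq]
      omega)
    rw [adjSwaps, ascSwaps]
    cases hxy : Nat.blt x y
    · have : f (y :: x :: t) = 0 := by
        refine hf _ (List.Perm.swap x y t) ?_
        have : ¬ x < y := by
          rw [← Nat.blt_eq, hxy]; simp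
        simp only [invCount, List.countP_cons]
        split_ifs <;> simp_all <;> omega
      simpa [List.map_map, Function.comp_def, this] using tail
    · simpa [List.map_map, Function.comp_def] using tail
  | case2 l hl =>
    rw [adjSwaps, ascSwaps] <;> exact hl

theorem pathCount_eq_ascPathCount (target : List ℕ) (m : ℕ) (l : List ℕ)
    (h : invCount l + m ≤ invCount target) :
    pathCount target m l = ascPathCount target m l ∧
      (invCount l + m < invCount target → ascPathCount target m l = 0) := by
  induction m generalizing l with
  | zero =>
    refine ⟨rfl, fun h => ?_⟩
    rw [ascPathCount, if_neg]
    rintro rfl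
    omega
  | succ m ih =>
    constructor
    · rw [pathCount, ascPathCount, sum_adjSwaps_eq_sum_ascSwaps]
      · congr 1
        refine List.map_congr_left fun s hs => (ih s ?_).1
        have := (perm_of_mem_ascSwaps hs).2
        omega
      · intro s _ hs
        rw [(ih s (by omega)).1]
        exact (ih s (by omega)).2 (by omega)
    · intro hlt
      rw [ascPathCount, List.sum_eq_zero]
      intro x hx
      obtain ⟨s, hs, rfl⟩ := List.mem_map.1 hx
      have := (perm_of_mem_ascSwaps hs).2
      exact (ih s (by omega)).2 (by omega)

/-- The number with the given base-`8` digits, least significant first. -/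
def encodeDigits : List ℕ → ℕ
  | [] => 0
  | x :: t => Nat.add x (Nat.mul (nat_lit 8) (encodeDigits t))

/-- The `n` least significant base-`8` digits of a number. -/
def decodeDigits : ℕ → ℕ → List ℕ
  | 0, _ => []
  | n + 1, k => k % 8 :: decodeDigits n (k / 8)

theorem decodeDigits_encodeDigits (l : List ℕ) (h : ∀ x ∈ l, x < 8) :
    decodeDigits l.length (encodeDigits l) = l := by
  induction l with
  | nil => rfl
  | cons x t ih =>
    have hx := h x (by simp)
    have h1 : (x + 8 * encodeDigits t) % 8 = x := by omega
    have h2 : (x + 8 * encodeDigits t) / 8 = encodeDigits t := by omega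
    rw [List.length_cons, encodeDigits, decodeDigits, Nat.add_eq, Nat.mul_eq, h1, h2,
      ih fun y hy => h y (List.mem_cons_of_mem x hy)]

theorem length_decodeDigits (n k : ℕ) : (decodeDigits n k).length = n := by
  induction n generalizing k with
  | zero => rfl
  | succ n ih => simp [decodeDigits, ih]

theorem lt_of_mem_decodeDigits {n k x : ℕ} (h : x ∈ decodeDigits n k) : x < 8 := by
  induction n generalizing k with
  | zero => simp [decodeDigits] at h
  | succ n ih =>
    rcases List.mem_cons.1 h with rfl | h
    · omega
    · exact ih h

theorem decodeDigits_encodeDigits_of_mem_ascSwaps {n k : ℕ} {l : List ℕ}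
    (h : l ∈ ascSwaps (decodeDigits n k)) : decodeDigits n (encodeDigits l) = l := by
  have hp := (perm_of_mem_ascSwaps h).1
  have := decodeDigits_encodeDigits l fun x hx => lt_of_mem_decodeDigits (hp.mem_iff.1 hx)
  rwa [hp.length_eq, length_decodeDigits] at this

/-- Pass `n` to `f`; in kernel reduction `n` is evaluated to a literal first. -/
def evalThen {α : Type} (n : ℕ) (f : ℕ → α) : α :=
  Nat.rec (f 0) (fun m _ => f m) (Nat.add n (nat_lit 1))

/-- Pass `decodeDigits n k` to `f`; in kernel reduction the digits are evaluated to literals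
first. -/
def decodeThen {α : Type} : ℕ → ℕ → (List ℕ → α) → α
  | 0, _, f => f []
  | n + 1, k, f =>
      evalThen (Nat.mod k (nat_lit 8)) fun x =>
        evalThen (Nat.div k (nat_lit 8)) fun k' => decodeThen n k' fun l => f (x :: l)

theorem decodeThen_eq {α : Type} (n k : ℕ) (f : List ℕ → α) :
    decodeThen n k f = f (decodeDigits n k) := by
  induction n generalizing k f with
  | zero => rfl
  | succ n ih => exact ih (k / 8) fun l => f (k % 8 :: l)

/-- Binary trees holding keys with multiplicities. -/
inductive KeyTree : Type
  | leaf : KeyTree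
  | node : KeyTree → ℕ → ℕ → KeyTree → KeyTree

namespace KeyTree

/-- The sum of `φ` over the keys of a tree, weighted by multiplicity. -/
def weightedSum (φ : ℕ → ℕ) : KeyTree → ℕ
  | leaf => 0
  | node l k c r => weightedSum φ l + c * φ k + weightedSum φ r

/-- Add the key `k` with multiplicity `c` to a tree, branching along the bits of `h`, and pass the
result to a continuation. -/
def insertThen {α : Type} (k c : ℕ) : KeyTree → ℕ → (KeyTree → α) → α
  | leaf, _, cont => cont (node leaf k c leaf)
  | node l k₀ c₀ r, h, cont =>
      cond (Nat.beq k k₀) (evalThen (Nat.add c₀ c) fun c' => cont (node l k₀ c' r))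
        (cond (Nat.beq (Nat.mod h (nat_lit 2)) (nat_lit 0))
          (evalThen (Nat.div h (nat_lit 2)) fun h' => insertThen k c l h' fun l' => cont (node l' k₀ c₀ r))
          (evalThen (Nat.div h (nat_lit 2)) fun h' => insertThen k c r h' fun r' => cont (node l k₀ c₀ r')))

/-- Add the encodings of all lists in a list, each with multiplicity `c`. -/
def insertAllThen {α : Type} (c : ℕ) : List (List ℕ) → KeyTree → (KeyTree → α) → α
  | [], t, cont => cont t
  | l :: ls, t, cont =>
      evalThen (encodeDigits l) fun k =>
        insertThen k c t k fun t' => insertAllThen c ls t' cont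

/-- Add all ascent swaps of the keys of the first tree to the second tree. -/
def stepThen {α : Type} (n : ℕ) : KeyTree → KeyTree → (KeyTree → α) → α
  | leaf, t, cont => cont t
  | node l k c r, t, cont =>
      decodeThen n k fun p =>
        insertAllThen c (ascSwaps p) t fun t₁ =>
          stepThen n l t₁ fun t₂ => stepThen n r t₂ cont

/-- The total number of paths of length `m` through ascents from the keys of a tree to `target`,
computed layer by layer. -/
def countPaths (n : ℕ) (target : List ℕ) : ℕ → KeyTree → ℕ
  | 0, t => weightedSum (fun k => ascPathCount target 0 (decodeDigits n k)) t
  | m + 1, t => stepThen n t leaf (countPaths n target m)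

theorem insertThen_spec {α : Type} (k c : ℕ) (t : KeyTree) (h : ℕ) (cont : KeyTree → α) :
    ∃ t', insertThen k c t h cont = cont t' ∧
      ∀ φ, weightedSum φ t' = weightedSum φ t + c * φ k := by
  induction t generalizing h cont with
  | leaf => exact ⟨_, rfl, fun φ => by simp [weightedSum]⟩
  | node l k₀ c₀ r ihl ihr =>
    rw [insertThen]
    cases hk : Nat.beq k k₀
    · cases Nat.beq (Nat.mod h 2) 0
      · obtain ⟨t', h1, h2⟩ := ihr (h / 2) fun r' => cont (node l k₀ c₀ r')
        exact ⟨_, h1, fun φ => by simp only [weightedSum, h2]; ring⟩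
      · obtain ⟨t', h1, h2⟩ := ihl (h / 2) fun l' => cont (node l' k₀ c₀ r)
        exact ⟨_, h1, fun φ => by simp only [weightedSum, h2]; ring⟩
    · obtain rfl := Nat.eq_of_beq_eq_true hk
      exact ⟨_, rfl, fun φ => by simp only [weightedSum, Nat.add_eq]; ring⟩

theorem insertAllThen_spec {α : Type} (c : ℕ) (ls : List (List ℕ)) (t : KeyTree)
    (cont : KeyTree → α) :
    ∃ t', insertAllThen c ls t cont = cont t' ∧
      ∀ φ, weightedSum φ t' =
        weightedSum φ t + c * (ls.map fun l => φ (encodeDigits l)).sum := by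
  induction ls generalizing t with
  | nil => exact ⟨t, rfl, fun φ => by simp⟩
  | cons l ls ih =>
    obtain ⟨t₁, h1, h2⟩ := insertThen_spec (encodeDigits l) c t (encodeDigits l)
      fun t' => insertAllThen c ls t' cont
    obtain ⟨t₂, h3, h4⟩ := ih t₁
    exact ⟨t₂, h1.trans h3, fun φ => by
      rw [h4, h2, List.map_cons, List.sum_cons]; ring⟩

theorem stepThen_spec {α : Type} (n : ℕ) (s t : KeyTree) (cont : KeyTree → α) :
    ∃ t', stepThen n s t cont = cont t' ∧
      ∀ φ, weightedSum φ t' = weightedSum φ t +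
        weightedSum (fun k => ((ascSwaps (decodeDigits n k)).map
          fun l => φ (encodeDigits l)).sum) s := by
  induction s generalizing t cont with
  | leaf => exact ⟨t, rfl, fun φ => rfl⟩
  | node l k c r ihl ihr =>
    obtain ⟨t₁, h1, h1'⟩ := insertAllThen_spec c (ascSwaps (decodeDigits n k)) t
      fun t₁ => stepThen n l t₁ fun t₂ => stepThen n r t₂ cont
    obtain ⟨t₂, h2, h2'⟩ := ihl t₁ fun t₂ => stepThen n r t₂ cont
    obtain ⟨t₃, h3, h3'⟩ := ihr t₂ cont
    exact ⟨t₃, (decodeThen_eq n k _).trans ((h1.trans h2).trans h3), fun φ => by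
      rw [h3', h2', h1']
      simp only [weightedSum]
      ring⟩

theorem countPaths_eq (n : ℕ) (target : List ℕ) (m : ℕ) (t : KeyTree) :
    countPaths n target m t =
      weightedSum (fun k => ascPathCount target m (decodeDigits n k)) t := by
  induction m generalizing t with
  | zero => rfl
  | succ m ih =>
    obtain ⟨t', h1, h2⟩ := stepThen_spec n t leaf (countPaths n target m)
    rw [countPaths, h1, ih, h2]
    simp only [weightedSum, zero_add]
    congr 1
    funext k
    rw [ascPathCount]
    congr 1
    exact List.map_congr_left fun l hl => by
      rw [decodeDigits_encodeDigits_of_mem_ascSwaps hl]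

end KeyTree

theorem countPaths_seven :
    KeyTree.countPaths 7 [7, 6, 5, 4, 3, 2, 1] 21
      (.node .leaf (encodeDigits [1, 2, 3, 4, 5, 6, 7]) 1 .leaf) = 1100742656 := by
  decide +kernel

theorem pathCount_seven :
    pathCount [7, 6, 5, 4, 3, 2, 1] 21 [1, 2, 3, 4, 5, 6, 7] = 1100742656 := by
  rw [(pathCount_eq_ascPathCount _ _ _ (by decide)).1, ← countPaths_seven, KeyTree.countPaths_eq]
  have : decodeDigits 7 (encodeDigits [1, 2, 3, 4, 5, 6, 7]) = [1, 2, 3, 4, 5, 6, 7] := by decide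
  simp only [KeyTree.weightedSum, this]
  ring

theorem sum_range_swapAt (f : List ℕ → ℕ) (l : List ℕ) :
    ∑ i ∈ Finset.range (l.length - 1), f (swapAt i l) = ((adjSwaps l).map f).sum := by
  induction l using adjSwaps.induct generalizing f with
  | case1 x y t ih =>
    have := ih fun s => f (x :: s)
    rw [adjSwaps, show (x :: y :: t).length - 1 = ((y :: t).length - 1) + 1 by simp,
      Finset.sum_range_succ']
    simp only [swapAt]
    rw [this, List.map_cons, List.sum_cons, List.map_map, add_comm]
    rfl
  | case2 l hl =>
    match l, hl with
    | [], _ => rfl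
    | [_], _ => rfl
    | x :: y :: t, hl => exact absurd rfl (hl x y t)

/-- The values `π 1, …, π n`. -/
def oneLine (n : ℕ) (π : Equiv.Perm ℕ) : List ℕ := (List.range' 1 n).map π

theorem swapAt_map_range' (i b n : ℕ) (hi : i + 1 < n) (π : Equiv.Perm ℕ) :
    swapAt i ((List.range' b n).map π) =
      (List.range' b n).map (π * adjTransposition (b + i)) := by
  induction i generalizing b n with
  | zero =>
    obtain ⟨n, rfl⟩ : ∃ m, n = m + 2 := ⟨n - 2, by omega⟩
    simp only [List.range'_succ, List.map_cons, swapAt, adjTransposition, Equiv.Perm.mul_apply,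
      add_zero, Equiv.swap_apply_left, Equiv.swap_apply_right, List.cons.injEq, true_and]
    refine List.map_congr_left fun x hx => ?_
    have := List.mem_range'_1.1 hx
    rw [Equiv.Perm.mul_apply, Equiv.swap_apply_of_ne_of_ne] <;> omega
  | succ i ih =>
    obtain ⟨n, rfl⟩ : ∃ m, n = m + 1 := ⟨n - 1, by omega⟩
    rw [List.range'_succ, List.map_cons, List.map_cons, swapAt, ih _ _ (by omega),
      show b + 1 + i = b + (i + 1) by ring]
    congr 1
    rw [Equiv.Perm.mul_apply, adjTransposition, Equiv.swap_apply_of_ne_of_ne] <;> omega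

open Classical in
/-- The words of length `m` in the letters `1, …, n - 1` that lead from `π` to `σ`. -/
noncomputable def wordsBetween (n : ℕ) (σ : Equiv.Perm ℕ) : ℕ → Equiv.Perm ℕ → Finset (List ℕ)
  | 0, π => if π = σ then {[]} else ∅
  | m + 1, π => (Finset.range (n - 1)).biUnion fun i =>
      (wordsBetween n σ m (π * adjTransposition (1 + i))).map
        ⟨List.cons (1 + i), List.cons_injective⟩

theorem mem_wordsBetween (n : ℕ) (σ : Equiv.Perm ℕ) (m : ℕ) (π : Equiv.Perm ℕ) (w : List ℕ) :
    w ∈ wordsBetween n σ m π ↔ w.length = m ∧ (∀ a ∈ w, 1 ≤ a ∧ a ≤ n - 1) ∧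
      π * (w.map adjTransposition).prod = σ := by
  induction m generalizing π w with
  | zero =>
    rw [wordsBetween, List.length_eq_zero_iff]
    split_ifs with h
    · simp only [Finset.mem_singleton]
      exact ⟨fun hw => by subst hw; simpa using h, fun hw => hw.1⟩
    · simp only [Finset.notMem_empty, false_iff]
      rintro ⟨rfl, -, h'⟩
      exact h (by simpa using h')
  | succ m ih =>
    simp only [wordsBetween, Finset.mem_biUnion, Finset.mem_range, Finset.mem_map,
      Function.Embedding.coeFn_mk, ih]
    constructor
    · rintro ⟨i, hi, v, ⟨h1, h2, h3⟩, rfl⟩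
      refine ⟨by simp [h1], ?_, by simpa [mul_assoc] using h3⟩
      intro a ha
      rcases List.mem_cons.1 ha with rfl | ha
      · omega
      · exact h2 a ha
    · rintro ⟨h1, h2, h3⟩
      cases w with
      | nil => simp at h1
      | cons a v =>
        have ha := h2 a (by simp)
        have hadd : 1 + (a - 1) = a := by omega
        refine ⟨a - 1, by omega, v, ⟨by simpa using h1, fun b hb => h2 b (by simp [hb]), ?_⟩, ?_⟩
        · rw [hadd]
          simpa [mul_assoc] using h3
        · rw [hadd]

theorem oneLine_injective {n : ℕ} {π σ : Equiv.Perm ℕ} (hπ : ∀ x, ¬ (1 ≤ x ∧ x ≤ n) → π x = x)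
    (hσ : ∀ x, ¬ (1 ≤ x ∧ x ≤ n) → σ x = x) (h : oneLine n π = oneLine n σ) : π = σ := by
  ext x
  by_cases hx : 1 ≤ x ∧ x ≤ n
  · exact List.map_inj_left.1 h x (List.mem_range'_1.2 (by omega))
  · rw [hπ x hx, hσ x hx]

theorem card_wordsBetween (n : ℕ) (σ : Equiv.Perm ℕ) (hσ : ∀ x, ¬ (1 ≤ x ∧ x ≤ n) → σ x = x)
    (m : ℕ) (π : Equiv.Perm ℕ) (hπ : ∀ x, ¬ (1 ≤ x ∧ x ≤ n) → π x = x) :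
    (wordsBetween n σ m π).card = pathCount (oneLine n σ) m (oneLine n π) := by
  induction m generalizing π with
  | zero =>
    rw [wordsBetween, pathCount]
    by_cases h : π = σ
    · simp [h]
    · rw [if_neg h, if_neg fun h' => h (oneLine_injective hπ hσ h'), Finset.card_empty]
  | succ m ih =>
    rw [wordsBetween, Finset.card_biUnion, pathCount, ← sum_range_swapAt,
      show (oneLine n π).length = n by simp [oneLine]]
    · refine Finset.sum_congr rfl fun i hi => ?_
      have hi := Finset.mem_range.1 hi
      rw [Finset.card_map, ih, oneLine, oneLine, oneLine,
        swapAt_map_range' i 1 n (by omega)]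
      intro x hx
      rw [Equiv.Perm.mul_apply, adjTransposition, Equiv.swap_apply_of_ne_of_ne, hπ x hx] <;> omega
    · intro i _ j _ hij
      refine Finset.disjoint_left.2 fun w hi hj => hij ?_
      obtain ⟨u, -, rfl⟩ := Finset.mem_map.1 hi
      obtain ⟨v, -, hv⟩ := Finset.mem_map.1 hj
      have := (List.cons.inj hv).1
      omega

/-- The number of reduced words for the long word `[7,6,5,4,3,2,1]` in `S₇` is
`1100742656`. -/
theorem reduced_words_S7_count :
    Nat.card {w : List ℕ // IsReducedWord 7 w} = 1100742656 := by
  have hmem : ∀ w, w ∈ wordsBetween 7 (longWord 7) 21 1 ↔ IsReducedWord 7 w := by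
    intro w
    rw [mem_wordsBetween, IsReducedWord, one_mul, show Nat.choose 7 2 = 21 by decide]
  rw [Nat.subtype_card _ hmem, card_wordsBetween]
  · exact pathCount_seven
  · exact fun x hx => if_neg hx
  · exact fun x _ => rfl
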